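/- Assume m_i = m for all i ∈ I, and that there exist ν > 0, μ ∈ ℝ and diagonal positive definite matrices Q_i = diag[Q_i⁻, Q_i⁺] ∈ ℝ^{n×n} (Q_i⁻ ∈ ℝ^{m×m}, Q_i⁺ ∈ ℝ^{(n−m)×(n−m)}) such that, setting 𝒬_i(x) = diag[e^{2μx} Q_i⁻, e^{−2μx} Q_i⁺], for every i ∈ I and x ∈ [0,1]: −2μ𝒬_i(x)Λ_i⁺ + F_iᵀ𝒬_i(x) + 𝒬_i(x)F_i ≤ −2ν𝒬_i(x), and E₀ᵢᵀ 𝒬_i(0) Λ_i E₀ᵢ ≤ E₁ᵢᵀ 𝒬_i(1) Λ_i E₁ᵢ where E₀ᵢ = [[I_m, 0],[G_{i+−}, G_{i++}]] and E₁ᵢ = [[G_{i−−}, G_{i−+}],[0, I_{n−m}]], together with (S_i⁺)ᵀQ_i⁺S_i⁺ = (S_j⁺)ᵀQ_j⁺S_j⁺ and (S_i⁻)ᵀQ_i⁻S_i⁻ = (S_j⁻)ᵀQ_j⁻S_j⁻ for all i,j ∈ I. Then the switched linear hyperbolic system is globally uniformly exponentially stable with respect to the set of all switching signals: there exist ν'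 > 0 and C > 0 such that for every switching signal σ and every classical solution w of the switched system, ‖w(t,·)‖_{L²((0,1);ℝⁿ)} ≤ C e^{−ν't} ‖w(0,·)‖_{L²((0,1);ℝⁿ)} for all t ≥ 0. -/

import Mathlib

open Matrix Set Real

noncomputable section

/-- Loewner order on real matrices: `matLE A B` iff `B - A` is positive semidefinite. -/
def matLE {ι : Type*} [Fintype ι] (A B : Matrix ι ι ℝ) : Prop := (B - A).PosSemidef

theorem dotProduct_transpose_mul_diagonal_mul_mulVec {ι : Type*} [Fintype ι] [DecidableEq ι]
    (B : Matrix ι ι ℝ) (d v : ι → ℝ) :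
    v ⬝ᵥ ((Bᵀ * diagonal d * B) *ᵥ v) = ∑ k, d k * (B *ᵥ v) k ^ 2 := by
  rw [← mulVec_mulVec, ← mulVec_mulVec, dotProduct_mulVec, vecMul_transpose, dotProduct]
  refine Finset.sum_congr rfl fun k _ => ?_
  rw [mulVec_diagonal]
  ring

theorem dotProduct_transpose_mul_diagonal_add_mulVec {ι : Type*} [Fintype ι] [DecidableEq ι]
    (F : Matrix ι ι ℝ) (d v : ι → ℝ) :
    v ⬝ᵥ ((Fᵀ * diagonal d + diagonal d * F) *ᵥ v) = ∑ k, 2 * d k * v k * (F *ᵥ v) k := by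
  rw [add_mulVec, ← mulVec_mulVec, ← mulVec_mulVec, dotProduct_add, dotProduct_mulVec,
    vecMul_transpose, dotProduct, dotProduct, ← Finset.sum_add_distrib]
  refine Finset.sum_congr rfl fun k _ => ?_
  rw [mulVec_diagonal, mulVec_diagonal]
  ring

theorem matLE.dotProduct_mulVec_le {ι : Type*} [Fintype ι] {A B : Matrix ι ι ℝ}
    (h : matLE A B) (v : ι → ℝ) : v ⬝ᵥ (A *ᵥ v) ≤ v ⬝ᵥ (B *ᵥ v) := by
  have := h.dotProduct_mulVec_nonneg v
  rw [star_trivial, sub_mulVec, dotProduct_sub] at this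
  linarith

theorem exists_sum_sq_mulVec_le {ι : Type*} [Fintype ι] (M : Matrix ι ι ℝ) :
    ∃ K > (0 : ℝ), ∀ v : ι → ℝ, ∑ k, (M *ᵥ v) k ^ 2 ≤ K * ∑ k, v k ^ 2 := by
  refine ⟨(∑ k, ∑ l, M k l ^ 2) + 1, by positivity, fun v => ?_⟩
  have h : ∑ k, (M *ᵥ v) k ^ 2 ≤ (∑ k, ∑ l, M k l ^ 2) * ∑ k, v k ^ 2 := by
    rw [Finset.sum_mul]
    exact Finset.sum_le_sum fun k _ => Finset.sum_mul_sq_le_sq_mul_sq _ _ _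
  have : 0 ≤ ∑ k, v k ^ 2 := by positivity
  linarith

/-- A quadratic form `v ↦ ∑ₖ exp (cₖ x) qₖ (S v)ₖ²` with `S` invertible and `q` positive is
equivalent to the Euclidean square norm, uniformly in `x ∈ [0, 1]`. -/
theorem exists_weighted_sum_sq_equiv {ι : Type*} [Fintype ι] [DecidableEq ι]
    (S : Matrix ι ι ℝ) (hS : IsUnit S) (c q : ι → ℝ) (hq : ∀ k, 0 < q k) :
    ∃ c₁ > (0 : ℝ), ∃ c₂ > (0 : ℝ), ∀ x ∈ Icc (0 : ℝ) 1, ∀ v : ι → ℝ,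
      c₁ * ∑ k, v k ^ 2 ≤ ∑ k, exp (c k * x) * q k * (S *ᵥ v) k ^ 2 ∧
      ∑ k, exp (c k * x) * q k * (S *ᵥ v) k ^ 2 ≤ c₂ * ∑ k, v k ^ 2 := by
  obtain ⟨K, hK, hSK⟩ := exists_sum_sq_mulVec_le S
  obtain ⟨K', hK', hSK'⟩ := exists_sum_sq_mulVec_le S⁻¹
  have hinv : ∀ v, S⁻¹ *ᵥ (S *ᵥ v) = v := fun v => by
    rw [mulVec_mulVec, nonsing_inv_mul _ ((isUnit_iff_isUnit_det S).1 hS), one_mulVec]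
  set B := ∑ k, |c k|
  set δ := (∑ k, (q k)⁻¹) + 1
  set Θ := (∑ k, q k) + 1
  have hδ : 0 < δ := by
    have : 0 ≤ ∑ k, (q k)⁻¹ := Finset.sum_nonneg fun k _ => (inv_pos.2 (hq k)).le
    positivity
  have hΘ : 0 < Θ := by
    have : 0 ≤ ∑ k, q k := Finset.sum_nonneg fun k _ => (hq k).le
    positivity
  have hδq : ∀ k, δ⁻¹ ≤ q k := fun k => by
    rw [inv_le_comm₀ hδ (hq k)]
    have := Finset.single_le_sum (f := fun k => (q k)⁻¹)
      (fun k _ => (inv_pos.2 (hq k)).le) (Finset.mem_univ k)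
    simp only [δ] at *
    linarith
  have hqΘ : ∀ k, q k ≤ Θ := fun k => by
    have := Finset.single_le_sum (f := q) (fun k _ => (hq k).le) (Finset.mem_univ k)
    simp only [Θ] at *
    linarith
  have hc : ∀ x ∈ Icc (0 : ℝ) 1, ∀ k, |c k * x| ≤ B := fun x hx k => by
    have := Finset.single_le_sum (f := fun k => |c k|)
      (fun k _ => abs_nonneg (c k)) (Finset.mem_univ k)
    rw [abs_mul, abs_of_nonneg hx.1]
    exact (mul_le_of_le_one_right (abs_nonneg _) hx.2).trans this
  refine ⟨exp (-B) * δ⁻¹ * K'⁻¹, by positivity, exp B * Θ * K, by positivity,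
    fun x hx v => ⟨?_, ?_⟩⟩
  · calc exp (-B) * δ⁻¹ * K'⁻¹ * ∑ k, v k ^ 2
        ≤ exp (-B) * δ⁻¹ * K'⁻¹ * (K' * ∑ k, (S *ᵥ v) k ^ 2) := by
          have := hSK' (S *ᵥ v)
          rw [hinv] at this
          gcongr
      _ = ∑ k, exp (-B) * δ⁻¹ * (S *ᵥ v) k ^ 2 := by
          rw [← Finset.mul_sum]
          field_simp
      _ ≤ _ := by
          refine Finset.sum_le_sum fun k _ => ?_
          have := neg_le_of_abs_le (hc x hx k)
          have := hδq k
          gcongr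
  · calc ∑ k, exp (c k * x) * q k * (S *ᵥ v) k ^ 2
        ≤ ∑ k, exp B * Θ * (S *ᵥ v) k ^ 2 := by
          refine Finset.sum_le_sum fun k _ => ?_
          have := le_of_abs_le (hc x hx k)
          have := hqΘ k
          have := (hq k).le
          gcongr
      _ = exp B * Θ * ∑ k, (S *ᵥ v) k ^ 2 := by rw [Finset.mul_sum]
      _ ≤ exp B * Θ * (K * ∑ k, v k ^ 2) := by
          have := hSK v
          gcongr
      _ = _ := by ring

theorem hasFDerivAt_exp_mul_sq {u : ℝ × ℝ → ℝ} {u' : ℝ × ℝ →L[ℝ] ℝ} {p : ℝ × ℝ}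
    (hu : HasFDerivAt u u' p) (r c s : ℝ) :
    HasFDerivAt (fun p : ℝ × ℝ => exp (r * p.1) * (exp (c * p.2) * s * u p ^ 2))
      (exp (r * p.1) • exp (c * p.2) • s •
        ((r * u p ^ 2) • ContinuousLinearMap.fst ℝ ℝ ℝ
          + (c * u p ^ 2) • ContinuousLinearMap.snd ℝ ℝ ℝ + (2 * u p) • u')) p := by
  have h1 : HasFDerivAt (fun p : ℝ × ℝ => exp (r * p.1)) _ p :=
    ((hasFDerivAt_fst (𝕜 := ℝ) (p := p)).const_mul r).exp
  have h2 : HasFDerivAt (fun p : ℝ × ℝ => exp (c * p.2)) _ p :=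
    ((hasFDerivAt_snd (𝕜 := ℝ) (p := p)).const_mul c).exp
  refine (h1.mul ((h2.mul_const s).mul (hu.pow 2))).congr_fderiv ?_
  ext <;> simp <;> ring

/-- Decay of the weighted energy of a solution of the diagonal system `y_t + Λ y_x = F y` on a
rectangle, under a pointwise dissipation inequality and a dissipative boundary condition. -/
theorem exp_mul_weighted_energy_le {ι : Type*} [Fintype ι] (ν a b : ℝ) (hab : a ≤ b)
    (lam c q : ι → ℝ) (F : Matrix ι ι ℝ) (y : ℝ × ℝ → ι → ℝ) (y' : ℝ × ℝ → ℝ × ℝ →L[ℝ] (ι → ℝ))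
    (hy : ContinuousOn y (Icc a b ×ˢ Icc (0 : ℝ) 1))
    (hy' : ∀ p ∈ Ioo a b ×ˢ Ioo (0 : ℝ) 1, HasFDerivAt y (y' p) p)
    (hpde : ∀ p ∈ Icc a b ×ˢ Icc (0 : ℝ) 1, ∀ k,
      y' p (1, 0) k + lam k * y' p (0, 1) k = (F *ᵥ y p) k)
    (hdiss : ∀ x ∈ Icc (0 : ℝ) 1, ∀ v : ι → ℝ, ∑ k, exp (c k * x) * q k *
      (2 * ν * v k ^ 2 + c k * lam k * v k ^ 2 + 2 * v k * (F *ᵥ v) k) ≤ 0)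
    (hbdry : ∀ t ∈ Icc a b,
      ∑ k, exp (c k * 0) * (q k * lam k) * y (t, 0) k ^ 2
        ≤ ∑ k, exp (c k * 1) * (q k * lam k) * y (t, 1) k ^ 2) :
    exp (2 * ν * b) * ∫ x in (0 : ℝ)..1, ∑ k, exp (c k * x) * q k * y (b, x) k ^ 2
      ≤ exp (2 * ν * a) * ∫ x in (0 : ℝ)..1, ∑ k, exp (c k * x) * q k * y (a, x) k ^ 2 := by
  have hyk : ∀ k, ContinuousOn (fun p => y p k) (Icc a b ×ˢ Icc (0 : ℝ) 1) := fun k =>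
    (continuous_apply k).comp_continuousOn hy
  have hFk : ∀ k, ContinuousOn (fun p => (F *ᵥ y p) k) (Icc a b ×ˢ Icc (0 : ℝ) 1) := fun k => by
    simp only [mulVec, dotProduct]
    fun_prop
  let D : (ι → ℝ) → ℝ × ℝ → ℝ × ℝ →L[ℝ] ℝ := fun s p =>
    ∑ k, exp (2 * ν * p.1) • exp (c k * p.2) • s k •
        ((2 * ν * y p k ^ 2) • ContinuousLinearMap.fst ℝ ℝ ℝ
          + (c k * y p k ^ 2) • ContinuousLinearMap.snd ℝ ℝ ℝ
          + (2 * y p k) • (ContinuousLinearMap.proj k).comp (y' p))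
  let f : (ι → ℝ) → ℝ × ℝ → ℝ := fun s p =>
    ∑ k, exp (2 * ν * p.1) * (exp (c k * p.2) * s k * y p k ^ 2)
  have hf : ∀ s, ContinuousOn (f s) (Icc a b ×ˢ Icc (0 : ℝ) 1) := fun s => by
    simp only [f]
    fun_prop
  have hD : ∀ s, ∀ p ∈ Ioo a b ×ˢ Ioo (0 : ℝ) 1, HasFDerivAt (f s) (D s p) p := fun s p hp =>
    HasFDerivAt.fun_sum fun k _ =>
      hasFDerivAt_exp_mul_sq (hasFDerivAt_pi'.1 (hy' p hp) k) (2 * ν) (c k) (s k)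
  have hdiv : ∀ p ∈ Icc a b ×ˢ Icc (0 : ℝ) 1,
      D q p (1, 0) + D (fun k => q k * lam k) p (0, 1)
        = exp (2 * ν * p.1) * ∑ k, exp (c k * p.2) * q k *
          (2 * ν * y p k ^ 2 + c k * lam k * y p k ^ 2 + 2 * y p k * (F *ᵥ y p) k) := by
    intro p hp
    simp only [D, _root_.sum_apply, Finset.mul_sum]
    rw [← Finset.sum_add_distrib]
    refine Finset.sum_congr rfl fun k _ => ?_
    rw [← hpde p hp k]
    simp
    ring
  have hIcc : Icc (a, (0 : ℝ)) (b, 1) = Icc a b ×ˢ Icc (0 : ℝ) 1 := (Icc_prod_Icc _ _ _ _).symm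
  have hmeas : MeasurableSet (Icc a b ×ˢ Icc (0 : ℝ) 1) := measurableSet_Icc.prod measurableSet_Icc
  have key := MeasureTheory.integral_divergence_prod_Icc_of_hasFDerivAt_of_le (f q)
    (f fun k => q k * lam k) (D q) (D fun k => q k * lam k) (a, 0) (b, 1)
    ⟨hab, zero_le_one⟩ (hIcc ▸ hf _) (hIcc ▸ hf _) (hD _) (hD _) (by
      rw [hIcc]
      refine MeasureTheory.IntegrableOn.congr_fun ?_ (fun p hp => (hdiv p hp).symm) hmeas
      refine ContinuousOn.integrableOn_compact (isCompact_Icc.prod isCompact_Icc) ?_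
      fun_prop)
  have hneg : ∫ p in Icc (a, (0 : ℝ)) (b, 1),
      D q p (1, 0) + D (fun k => q k * lam k) p (0, 1) ≤ 0 := by
    rw [hIcc]
    refine MeasureTheory.setIntegral_nonpos hmeas fun p hp => ?_
    rw [hdiv p hp]
    exact mul_nonpos_of_nonneg_of_nonpos (exp_pos _).le (hdiss p.2 hp.2 (y p))
  have hflux : ∫ t in a..b, f (fun k => q k * lam k) (t, 0)
      ≤ ∫ t in a..b, f (fun k => q k * lam k) (t, 1) := by
    have hint : ∀ x ∈ Icc (0 : ℝ) 1, IntervalIntegrable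
        (fun t => f (fun k => q k * lam k) (t, x)) MeasureTheory.volume a b := fun x hx => by
      refine ContinuousOn.intervalIntegrable_of_Icc hab ?_
      exact (hf _).comp (by fun_prop) fun t ht => ⟨ht, hx⟩
    refine intervalIntegral.integral_mono_on hab (hint 0 (by simp)) (hint 1 (by simp))
      fun t ht => ?_
    simp only [f, ← Finset.mul_sum]
    exact mul_le_mul_of_nonneg_left (hbdry t ht) (exp_pos _).le
  have hV : ∀ t, ∫ x in (0 : ℝ)..1, f q (t, x)
      = exp (2 * ν * t) * ∫ x in (0 : ℝ)..1, ∑ k, exp (c k * x) * q k * y (t, x) k ^ 2 :=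
    fun t => by simp only [f, ← Finset.mul_sum, intervalIntegral.integral_const_mul]
  rw [← hV, ← hV]
  simp only at key
  linarith

/-- A function that is nonincreasing across every interval free of points of a locally finite set
is nonincreasing. -/
theorem le_of_le_on_free_intervals {α : Type*} [Preorder α] (φ : ℝ → α) (times : Set ℝ)
    (hfin : ∀ T : ℝ, (times ∩ Icc 0 T).Finite)
    (hφ : ∀ a b : ℝ, 0 ≤ a → a < b → (∀ u, a < u → u < b → u ∉ times) → φ b ≤ φ a)
    {a b : ℝ} (ha : 0 ≤ a) (hab : a < b) : φ b ≤ φ a := by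
  have hf : ∀ {a b : ℝ}, 0 ≤ a → (times ∩ Ioo a b).Finite := fun {a b} ha =>
    (hfin b).subset (inter_subset_inter_right _ fun u hu => ⟨ha.trans hu.1.le, hu.2.le⟩)
  induction hN : (times ∩ Ioo a b).ncard using Nat.strong_induction_on generalizing a b with
  | _ N ih =>
    by_cases h : ∃ u ∈ times, a < u ∧ u < b
    · obtain ⟨u, hu, hau, hub⟩ := h
      have h1 : (times ∩ Ioo a u).ncard < N := hN ▸ Set.ncard_lt_ncard
        ⟨fun v hv => ⟨hv.1, hv.2.1, hv.2.2.trans hub⟩,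
          fun hs => lt_irrefl u (hs ⟨hu, hau, hub⟩).2.2⟩ (hf ha)
      have h2 : (times ∩ Ioo u b).ncard < N := hN ▸ Set.ncard_lt_ncard
        ⟨fun v hv => ⟨hv.1, hau.trans hv.2.1, hv.2.2⟩,
          fun hs => lt_irrefl u (hs ⟨hu, hau, hub⟩).2.1⟩ (hf ha)
      exact (ih _ h2 (ha.trans hau.le) hub rfl).trans (ih _ h1 ha hau rfl)
    · push Not at h
      exact hφ a b ha hab fun u hau hub hu => absurd hub (not_lt.2 (h u hu hau))

/-- Theorem (mode independent sign structure, arbitrary switching):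
under the common-Lyapunov matrix inequalities, the switched linear hyperbolic system is
globally uniformly exponentially stable with respect to all switching signals.
A switching signal is encoded by its values `sig : ℝ → I` together with its set `times`
of switching times (its discontinuities), and a classical solution is a continuous
function which is C¹ and satisfies the PDE and boundary conditions of the active mode
on every interval free of switching times. -/
theorem stmt_5
    (n : ℕ) (hn : 1 ≤ n) (I : Type) [Fintype I] [Nonempty I]
    (m : ℕ) (hm : m ≤ n)
    (S : I → Matrix (Fin n) (Fin n) ℝ) (hS : ∀ i, IsUnit (S i))
    (lam : I → Fin n → ℝ)
    (hlam : ∀ i (k : Fin n), if (k : ℕ) < m then lam i k < 0 else 0 < lam i k)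
    (A L F : I → Matrix (Fin n) (Fin n) ℝ)
    (hL : ∀ i, L i = (S i)⁻¹ * Matrix.diagonal (lam i) * S i)
    (hF : ∀ i, F i = S i * A i * (S i)⁻¹)
    (G : I → Matrix (Fin n) (Fin n) ℝ)
    (B0 B1 : I → Matrix (Fin n) (Fin n) ℝ)
    -- B⁰ᵢ = [[-Gᵢ₋₋, 0],[-Gᵢ₊₋, I]] Sᵢ  and  B¹ᵢ = [[I, -Gᵢ₋₊],[0, -Gᵢ₊₊]] Sᵢ
    (hB0 : ∀ i, B0 i = (Matrix.of fun k l : Fin n =>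
        if (l : ℕ) < m then -(G i k l) else if k = l then (1:ℝ) else 0) * S i)
    (hB1 : ∀ i, B1 i = (Matrix.of fun k l : Fin n =>
        if (l : ℕ) < m then (if k = l then (1:ℝ) else 0) else -(G i k l)) * S i)
    (ν μ : ℝ) (hν : 0 < ν)
    (q : I → Fin n → ℝ) (hq : ∀ i k, 0 < q i k)
    -- 𝒬ᵢ(x) = diag[e^{2μx} Qᵢ⁻, e^{-2μx} Qᵢ⁺]
    (Qx : I → ℝ → Matrix (Fin n) (Fin n) ℝ)
    (hQx : ∀ i x, Qx i x = Matrix.diagonal (fun k : Fin n =>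
        if (k : ℕ) < m then Real.exp (2 * μ * x) * q i k
        else Real.exp (-(2 * μ * x)) * q i k))
    -- E₀ᵢ = [[I, 0],[Gᵢ₊₋, Gᵢ₊₊]],  E₁ᵢ = [[Gᵢ₋₋, Gᵢ₋₊],[0, I]]
    (E0 E1 : I → Matrix (Fin n) (Fin n) ℝ)
    (hE0 : ∀ i, E0 i = Matrix.of fun k l : Fin n =>
        if (k : ℕ) < m then (if k = l then (1:ℝ) else 0) else G i k l)
    (hE1 : ∀ i, E1 i = Matrix.of fun k l : Fin n =>
        if (k : ℕ) < m then G i k l else if k = l then (1:ℝ) else 0)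
    (hlmi1 : ∀ i, ∀ x ∈ Icc (0:ℝ) 1,
      matLE (-(2 * μ) • (Qx i x * Matrix.diagonal (fun k => |lam i k|))
              + (F i)ᵀ * Qx i x + Qx i x * F i)
            (-(2 * ν) • Qx i x))
    (hlmi2 : ∀ i,
      matLE ((E0 i)ᵀ * (Qx i 0 * Matrix.diagonal (lam i)) * E0 i)
            ((E1 i)ᵀ * (Qx i 1 * Matrix.diagonal (lam i)) * E1 i))
    -- (Sᵢ⁻)ᵀ Qᵢ⁻ Sᵢ⁻ = (Sⱼ⁻)ᵀ Qⱼ⁻ Sⱼ⁻ and (Sᵢ⁺)ᵀ Qᵢ⁺ Sᵢ⁺ = (Sⱼ⁺)ᵀ Qⱼ⁺ Sⱼ⁺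
    (heqm : ∀ i j,
      (S i)ᵀ * Matrix.diagonal (fun k : Fin n => if (k : ℕ) < m then q i k else 0) * S i
        = (S j)ᵀ * Matrix.diagonal (fun k : Fin n => if (k : ℕ) < m then q j k else 0) * S j)
    (heqp : ∀ i j,
      (S i)ᵀ * Matrix.diagonal (fun k : Fin n => if (k : ℕ) < m then 0 else q i k) * S i
        = (S j)ᵀ * Matrix.diagonal (fun k : Fin n => if (k : ℕ) < m then 0 else q j k) * S j) :
    ∃ ν' > (0:ℝ), ∃ C > (0:ℝ),
      ∀ (sig : ℝ → I) (times : Set ℝ),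
        -- switching times are positive and locally finite
        (∀ t ∈ times, 0 < t) →
        (∀ T : ℝ, (times ∩ Icc 0 T).Finite) →
        -- `sig` is constant (hence right-continuous) between switching times
        (∀ s t : ℝ, 0 ≤ s → s ≤ t → (∀ u, s < u → u ≤ t → u ∉ times) → sig t = sig s) →
        -- switching times are genuine discontinuities of `sig`
        (∀ t ∈ times, ∀ ε > (0:ℝ), ∃ s, t - ε < s ∧ s < t ∧ sig s ≠ sig t) →
        ∀ w : ℝ → ℝ → Fin n → ℝ,
          -- `w` is continuous on [0,∞) × [0,1]
          ContinuousOn (fun pt : ℝ × ℝ => w pt.1 pt.2) (Ici (0:ℝ) ×ˢ Icc (0:ℝ) 1) →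
          -- on every interval free of switching times, `w` is C¹ and satisfies the PDE
          -- and the boundary conditions of the active mode
          (∀ a b : ℝ, 0 ≤ a → a < b → (∀ u, a < u → u < b → u ∉ times) →
            ContDiffOn ℝ 1 (fun pt : ℝ × ℝ => w pt.1 pt.2) (Icc a b ×ˢ Icc (0:ℝ) 1) ∧
            (∀ t ∈ Icc a b, ∀ x ∈ Icc (0:ℝ) 1,
              fderivWithin ℝ (fun pt : ℝ × ℝ => w pt.1 pt.2)
                  (Icc a b ×ˢ Icc (0:ℝ) 1) (t, x) (1, 0)
                + (L (sig a)).mulVec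
                    (fderivWithin ℝ (fun pt : ℝ × ℝ => w pt.1 pt.2)
                      (Icc a b ×ˢ Icc (0:ℝ) 1) (t, x) (0, 1))
                = (A (sig a)).mulVec (w t x)) ∧
            (∀ t ∈ Icc a b,
              (B0 (sig a)).mulVec (w t 0) + (B1 (sig a)).mulVec (w t 1) = 0)) →
          ∀ t ≥ (0:ℝ),
            Real.sqrt (∫ x in (0:ℝ)..1, ∑ k, (w t x k) ^ 2)
              ≤ C * Real.exp (-ν' * t) * Real.sqrt (∫ x in (0:ℝ)..1, ∑ k, (w 0 x k) ^ 2) := by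
  set c : Fin n → ℝ := fun k => if (k : ℕ) < m then 2 * μ else -(2 * μ) with hc
  have hQ : ∀ i x, Qx i x = diagonal fun k => exp (c k * x) * q i k := fun i x => by
    rw [hQx]
    congr 1
    ext k
    by_cases hk : (k : ℕ) < m <;> simp [hc, hk]
  have hclam : ∀ i k, c k * lam i k = -(2 * μ) * |lam i k| := fun i k => by
    have := hlam i k
    by_cases hk : (k : ℕ) < m
    · simp only [hk, if_true] at this
      simp [hc, hk, abs_of_neg this]
    · simp only [hk, if_false] at this
      simp [hc, hk, abs_of_pos this]
  have hSinv : ∀ i, (S i)⁻¹ * S i = 1 := fun i =>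
    nonsing_inv_mul _ ((isUnit_iff_isUnit_det _).1 (hS i))
  have hSinv' : ∀ i, S i * (S i)⁻¹ = 1 := fun i =>
    mul_nonsing_inv _ ((isUnit_iff_isUnit_det _).1 (hS i))
  -- the weighted quadratic form does not depend on the mode
  have hcommon : ∀ i j x v, ∑ k, exp (c k * x) * q i k * (S i *ᵥ v) k ^ 2
      = ∑ k, exp (c k * x) * q j k * (S j *ᵥ v) k ^ 2 := by
    intro i j x v
    have h1 := congrArg (fun M => v ⬝ᵥ (M *ᵥ v)) (heqm i j)
    have h2 := congrArg (fun M => v ⬝ᵥ (M *ᵥ v)) (heqp i j)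
    simp only [dotProduct_transpose_mul_diagonal_mul_mulVec] at h1 h2
    have hsplit : ∀ i, ∑ k, exp (c k * x) * q i k * (S i *ᵥ v) k ^ 2
        = exp (2 * μ * x) * ∑ k : Fin n, (if (k : ℕ) < m then q i k else 0) * (S i *ᵥ v) k ^ 2
          + exp (-(2 * μ) * x) *
            ∑ k : Fin n, (if (k : ℕ) < m then 0 else q i k) * (S i *ᵥ v) k ^ 2 := fun i => by
      rw [Finset.mul_sum, Finset.mul_sum, ← Finset.sum_add_distrib]
      refine Finset.sum_congr rfl fun k _ => ?_
      by_cases hk : (k : ℕ) < m <;> simp [hc, hk, mul_assoc]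
    rw [hsplit, hsplit, h1, h2]
  have hdiss : ∀ i, ∀ x ∈ Icc (0 : ℝ) 1, ∀ v : Fin n → ℝ, ∑ k, exp (c k * x) * q i k *
      (2 * ν * v k ^ 2 + c k * lam i k * v k ^ 2 + 2 * v k * (F i *ᵥ v) k) ≤ 0 := by
    intro i x hx v
    have h := (hlmi1 i x hx).dotProduct_mulVec_le v
    rw [add_assoc, add_mulVec, dotProduct_add, hQ,
      dotProduct_transpose_mul_diagonal_add_mulVec, smul_mulVec, smul_mulVec,
      dotProduct_smul, dotProduct_smul, diagonal_mul_diagonal] at h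
    simp only [dotProduct, mulVec_diagonal, smul_eq_mul, Finset.mul_sum] at h
    rw [← Finset.sum_add_distrib, ← sub_nonpos, ← Finset.sum_sub_distrib] at h
    refine le_of_eq_of_le (Finset.sum_congr rfl fun k _ => ?_) h
    rw [hclam]
    ring
  have hbdry : ∀ i (u v : Fin n → ℝ), B0 i *ᵥ u + B1 i *ᵥ v = 0 →
      ∑ k, exp (c k * 0) * (q i k * lam i k) * (S i *ᵥ u) k ^ 2
        ≤ ∑ k, exp (c k * 1) * (q i k * lam i k) * (S i *ᵥ v) k ^ 2 := by
    intro i u v huv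
    -- the boundary data consist of the incoming components at the two ends
    set ξ : Fin n → ℝ := fun k => if (k : ℕ) < m then (S i *ᵥ u) k else (S i *ᵥ v) k with hξ
    have hrow : ∀ k, (E0 i *ᵥ ξ) k = (S i *ᵥ u) k ∧ (E1 i *ᵥ ξ) k = (S i *ᵥ v) k := by
      intro k
      have hk := congrFun huv k
      have hsum : (B0 i *ᵥ u + B1 i *ᵥ v) k
          = (if (k : ℕ) < m then (S i *ᵥ v) k else (S i *ᵥ u) k) - (G i *ᵥ ξ) k := by
        have hite : (if (k : ℕ) < m then (S i *ᵥ v) k else (S i *ᵥ u) k)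
            = ∑ l, if k = l then (if (l : ℕ) < m then (S i *ᵥ v) l else (S i *ᵥ u) l) else 0 := by
          simp
        rw [hB0, hB1, ← mulVec_mulVec, ← mulVec_mulVec, hite, Pi.add_apply]
        simp only [mulVec, dotProduct]
        rw [← Finset.sum_add_distrib, ← Finset.sum_sub_distrib]
        refine Finset.sum_congr rfl fun l _ => ?_
        by_cases hl : (l : ℕ) < m <;> by_cases hkl : k = l <;>
          simp [hl, hkl, hξ, mulVec, dotProduct] <;> ring
      rw [hsum, Pi.zero_apply, sub_eq_zero] at hk
      have hG : ∀ M : Matrix (Fin n) (Fin n) ℝ, (∀ l, M k l = G i k l) →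
          (M *ᵥ ξ) k = (G i *ᵥ ξ) k := fun M hM => by simp [mulVec, dotProduct, hM]
      have h1 : ∀ M : Matrix (Fin n) (Fin n) ℝ, (∀ l, M k l = if k = l then 1 else 0) →
          (M *ᵥ ξ) k = ξ k := fun M hM => by simp [mulVec, dotProduct, hM]
      by_cases hkm : (k : ℕ) < m
      · rw [if_pos hkm] at hk
        exact ⟨(h1 _ fun l => by simp [hE0, hkm]).trans (by simp [hξ, hkm]),
          (hG _ fun l => by simp [hE1, hkm]).trans hk.symm⟩
      · rw [if_neg hkm] at hk
        exact ⟨(hG _ fun l => by simp [hE0, hkm]).trans hk.symm,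
          (h1 _ fun l => by simp [hE1, hkm]).trans (by simp [hξ, hkm])⟩
    have h := (hlmi2 i).dotProduct_mulVec_le ξ
    rw [hQ, hQ, diagonal_mul_diagonal, diagonal_mul_diagonal,
      dotProduct_transpose_mul_diagonal_mul_mulVec,
      dotProduct_transpose_mul_diagonal_mul_mulVec] at h
    simpa only [(hrow _).1, (hrow _).2, mul_assoc] using h
  obtain ⟨i₀⟩ := ‹Nonempty I›
  obtain ⟨c₁, hc₁, c₂, hc₂, hequiv⟩ := exists_weighted_sum_sq_equiv (S i₀) (hS i₀) c (q i₀) (hq i₀)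
  refine ⟨ν, hν, √(c₂ / c₁), by positivity, ?_⟩
  intro sig times _ hfin _ _ w hw hsol t ht
  have hwt : ∀ t, 0 ≤ t → ContinuousOn (w t) (Icc 0 1) := fun t ht =>
    hw.comp (f := fun x => (t, x)) (by fun_prop) fun x hx => ⟨ht, hx⟩
  set V : ℝ → ℝ := fun t => exp (2 * ν * t) *
    ∫ x in (0 : ℝ)..1, ∑ k, exp (c k * x) * q i₀ k * (S i₀ *ᵥ w t x) k ^ 2 with hV
  have hdecay : V t ≤ V 0 := by
    rcases ht.eq_or_lt with rfl | ht
    · exact le_rfl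
    refine le_of_le_on_free_intervals V times hfin (fun a b ha hab hfree => ?_) le_rfl ht
    obtain ⟨hC1, hpde, hbc⟩ := hsol a b ha hab hfree
    set i := sig a
    set R := Icc a b ×ˢ Icc (0 : ℝ) 1 with hR
    set W : ℝ × ℝ → Fin n → ℝ := fun p => w p.1 p.2
    let T : (Fin n → ℝ) →L[ℝ] (Fin n → ℝ) := LinearMap.toContinuousLinearMap (S i).mulVecLin
    have hT : ∀ v, T v = S i *ᵥ v := fun v => rfl
    have key := exp_mul_weighted_energy_le ν a b hab.le (lam i) c (q i) (F i)
      (fun p => S i *ᵥ W p) (fun p => T.comp (fderivWithin ℝ W R p))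
      (T.continuous.comp_continuousOn hC1.continuousOn)
      (fun p hp => by
        have hmem : R ∈ nhds p :=
          prod_mem_nhds (Icc_mem_nhds hp.1.1 hp.1.2) (Icc_mem_nhds hp.2.1 hp.2.2)
        exact T.hasFDerivAt.comp p
          (((hC1.differentiableOn one_ne_zero) p (mem_of_mem_nhds hmem)).hasFDerivWithinAt.hasFDerivAt
            hmem))
      (fun p hp k => by
        have h := congrArg (S i *ᵥ ·) (hpde p.1 hp.1 p.2 hp.2)
        have hSL : S i * L i = diagonal (lam i) * S i := by
          rw [hL, ← mul_assoc, ← mul_assoc, hSinv', one_mul]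
        have hSA : S i * A i = F i * S i := by
          rw [hF, mul_assoc, hSinv, mul_one]
        simp only [mulVec_add, mulVec_mulVec, hSL, hSA] at h
        simp only [← mulVec_mulVec] at h
        have hk := congrFun h k
        rw [Pi.add_apply, mulVec_diagonal] at hk
        exact hk)
      (hdiss i) (fun t ht => hbdry i _ _ (hbc t ht))
    simp only [hV, hcommon i₀ i]
    exact key
  have hcont : ∀ t, 0 ≤ t → ∀ k, ContinuousOn (fun x => w t x k) (Icc 0 1) := fun t ht k =>
    (continuous_apply k).comp_continuousOn (hwt t ht)
  have hint : ∀ t, 0 ≤ t → IntervalIntegrable (fun x => ∑ k, w t x k ^ 2)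
      MeasureTheory.volume 0 1 := fun t ht => by
    have := hcont t ht
    refine ContinuousOn.intervalIntegrable_of_Icc zero_le_one ?_
    fun_prop
  have hintV : ∀ t, 0 ≤ t → IntervalIntegrable
      (fun x => ∑ k, exp (c k * x) * q i₀ k * (S i₀ *ᵥ w t x) k ^ 2)
      MeasureTheory.volume 0 1 := fun t ht => by
    have := hcont t ht
    refine ContinuousOn.intervalIntegrable_of_Icc zero_le_one ?_
    simp only [mulVec, dotProduct]
    fun_prop
  have hlow := intervalIntegral.integral_mono_on zero_le_one ((hint t ht).const_mul c₁)
    (hintV t ht) fun x hx => (hequiv x hx _).1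
  have hup := intervalIntegral.integral_mono_on zero_le_one (hintV 0 le_rfl)
    ((hint 0 le_rfl).const_mul c₂) fun x hx => (hequiv x hx _).2
  rw [intervalIntegral.integral_const_mul] at hlow hup
  simp only [hV, mul_zero, exp_zero, one_mul] at hdecay
  have hexp : exp (-ν * t) = √(exp (2 * ν * t))⁻¹ := by
    rw [← exp_neg, ← exp_half]
    ring_nf
  rw [hexp, ← sqrt_mul (by positivity), ← sqrt_mul (by positivity)]
  refine sqrt_le_sqrt ?_
  have hpos := exp_pos (2 * ν * t)
  calc ∫ x in (0 : ℝ)..1, ∑ k, w t x k ^ 2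
      = (c₁ * exp (2 * ν * t))⁻¹ *
          (exp (2 * ν * t) * (c₁ * ∫ x in (0 : ℝ)..1, ∑ k, w t x k ^ 2)) := by
        field_simp
    _ ≤ (c₁ * exp (2 * ν * t))⁻¹ * (c₂ * ∫ x in (0 : ℝ)..1, ∑ k, w 0 x k ^ 2) := by
        refine mul_le_mul_of_nonneg_left ?_ (by positivity)
        exact (mul_le_mul_of_nonneg_left hlow hpos.le).trans (hdecay.trans hup)
    _ = _ := by
        field_simp
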